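/- arXiv:2206.04660 — 2 statements merged into one kernel-verified Lean document; each statement's English description precedes it below -/
import Mathlib

section
/- Let 21 ∈ S_2 denote the inversion pattern and let ℱ(21,ξ,θ) ⊆ ℳ be the set of maximizers of sup_{ν∈ℳ}{θ t_{21}(ν) − D(ν|ξ)}. Then ℱ(21,ξ,θ) = {ξ} for every θ ≤ 1, while for every θ > 1, ℱ(21,ξ,θ) = { ((1+m_θ)/2)·ξ₁₁ + ((1−m_θ)/2)·ξ₂₂ , ((1−m_θ)/2)·ξ₁₁ + ((1+m_θ)/2)·ξ₂₂ }, where m_θ is the unique positive root of the equation x = tanh(θx). Moreover, for every θ > 1 the set 𝒪(ℱ(21,ξ,θ)) := {𝒪(ν) : ν ∈ ℱ(21,ξ,θ)} has exactly two elements. -/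
open MeasureTheory Filter Topology
open scoped ENNReal

noncomputable section

/-- The plane `ℝ²`, carrier for measures on the unit square. -/
abbrev Ω2 : Type := ℝ × ℝ

/-- The unit square `[0,1]² ⊆ ℝ²`. -/
def unitSq : Set Ω2 := Set.Icc (0 : ℝ) 1 ×ˢ Set.Icc (0 : ℝ) 1

/-- Lebesgue measure on the unit square. -/
def lebSq : Measure Ω2 := volume.restrict unitSq

/-- `𝒫`: Borel probability measures concentrated on the unit square. -/
def Pcal : Set (ProbabilityMeasure Ω2) := {μ | (μ : Measure Ω2) unitSq = 1}

/-- `ℳ`: members of `𝒫` whose two coordinate marginals are atomless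
(equivalently, have continuous CDFs). -/
def Mcal : Set (ProbabilityMeasure Ω2) :=
  {μ | μ ∈ Pcal ∧ (∀ x : ℝ, (μ : Measure Ω2).map Prod.fst {x} = 0) ∧
      ∀ y : ℝ, (μ : Measure Ω2).map Prod.snd {y} = 0}

/-- The uniform distribution on `[0,1]`. -/
def unif01 : Measure ℝ := volume.restrict (Set.Icc (0 : ℝ) 1)

/-- `ℳ̃`: permutons, i.e. members of `𝒫` with both marginals uniform on `[0,1]`. -/
def Mtilde : Set (ProbabilityMeasure Ω2) :=
  {μ | μ ∈ Pcal ∧ (μ : Measure Ω2).map Prod.fst = unif01 ∧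
      (μ : Measure Ω2).map Prod.snd = unif01}

open scoped Classical in
/-- `h_σ`: indicator that the `k` points induce the pattern `σ`. -/
def hPat {k : ℕ} (σ : Equiv.Perm (Fin k)) (z : Fin k → Ω2) : ℝ :=
  if ∃ τ : Equiv.Perm (Fin k),
      StrictMono (fun i => (z (τ i)).1) ∧ StrictMono (fun i => (z (τ (σ⁻¹ i))).2)
  then 1 else 0

/-- Pattern density `t_σ(ν) = ∫ h_σ dν^{⊗k}`. -/
def tPat {k : ℕ} (σ : Equiv.Perm (Fin k)) (ν : Measure Ω2) : ℝ :=
  ∫ z, hPat σ z ∂(Measure.pi fun _ : Fin k => ν)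

open scoped Classical in
/-- The permutation induced by `n` labelled points of `ℝ²` (junk value `1` if the
coordinates are not in generic position). -/
def inducedPerm {n : ℕ} (z : Fin n → Ω2) : Equiv.Perm (Fin n) :=
  if h : ∃ σ : Equiv.Perm (Fin n), hPat σ z = 1 then h.choose else 1

/-- Empirical measure `Em(π) = (1/n) ∑ δ_{(i/n, π(i)/n)}` of a permutation, as a measure. -/
def EmM {n : ℕ} (π : Equiv.Perm (Fin n)) : Measure Ω2 :=
  (n : ℝ≥0∞)⁻¹ • ∑ i : Fin n, Measure.dirac ((((i : ℕ) + 1 : ℝ)) / n, (((π i : ℕ) + 1 : ℝ)) / n)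

open scoped Classical in
/-- Empirical measure of a permutation as a probability measure (junk value for `n = 0`). -/
def EmP {n : ℕ} (π : Equiv.Perm (Fin n)) : ProbabilityMeasure Ω2 :=
  if h : IsProbabilityMeasure (EmM π) then ⟨EmM π, h⟩
  else ⟨Measure.dirac 0, by infer_instance⟩

/-- `t_σ(π) := t_σ(Em(π))`. -/
def tPerm {k n : ℕ} (σ : Equiv.Perm (Fin k)) (π : Equiv.Perm (Fin n)) : ℝ := tPat σ (EmM π)

open scoped Classical in
/-- Kullback–Leibler divergence `D(ν|μ) ∈ [0,∞]`; for probability measures with `ν ≪ μ`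
it equals `∫ log(dν/dμ) dν`, written here through the nonnegative integrand
`g log g + 1 - g` of the density `g = dν/dμ` (the correction `∫ (1-g) dμ = 0`). -/
def KL (ν μ : Measure Ω2) : ℝ≥0∞ :=
  if ν ≪ μ then
    ∫⁻ z, ENNReal.ofReal ((ν.rnDeriv μ z).toReal * Real.log ((ν.rnDeriv μ z).toReal)
      + 1 - (ν.rnDeriv μ z).toReal) ∂μ
  else ∞

/-- CDF of the first marginal. -/
def cdfX (μ : Measure Ω2) (x : ℝ) : ℝ := (μ {p : Ω2 | p.1 ≤ x}).toReal

/-- CDF of the second marginal. -/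
def cdfY (μ : Measure Ω2) (y : ℝ) : ℝ := (μ {p : Ω2 | p.2 ≤ y}).toReal

/-- The map `𝒪`: pushforward of `μ` under `(x,y) ↦ (F₁(x), F₂(y))`. -/
def Omap (μ : Measure Ω2) : Measure Ω2 := μ.map fun p => (cdfX μ p.1, cdfY μ p.2)

/-- The product measure `μ^{⊗n}` governing `n` i.i.d. samples. -/
def pmeas (μ : Measure Ω2) (n : ℕ) : Measure (Fin n → Ω2) := Measure.pi fun _ => μ

/-- Log-partition function `F_n(σ,μ,θ) = log E[exp(nθ t_σ(π_{n,μ}))]`. -/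
def Fn {k : ℕ} (σ : Equiv.Perm (Fin k)) (μ : Measure Ω2) (θ : ℝ) (n : ℕ) : ℝ :=
  Real.log (∫ z, Real.exp (n * θ * tPerm σ (inducedPerm z)) ∂pmeas μ n)

/-- The Gibbs measure `Q_{n,σ,μ,θ}` on `([0,1]²)ⁿ`. -/
def Qgibbs {k : ℕ} (σ : Equiv.Perm (Fin k)) (μ : Measure Ω2) (θ : ℝ) (n : ℕ) :
    Measure (Fin n → Ω2) :=
  (pmeas μ n).withDensity fun z =>
    ENNReal.ofReal (Real.exp (n * θ * tPerm σ (inducedPerm z) - Fn σ μ θ n))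

/-- `F(σ,μ,θ) = sup_{ν ∈ ℳ} { θ t_σ(ν) − D(ν|μ) }`, valued in `EReal`. -/
def Fsup {k : ℕ} (σ : Equiv.Perm (Fin k)) (μ : Measure Ω2) (θ : ℝ) : EReal :=
  ⨆ ν ∈ Mcal, (((θ * tPat σ (ν : Measure Ω2) : ℝ) : EReal) - ((KL (↑ν) μ : ℝ≥0∞) : EReal))

/-- `ℱ(σ,μ,θ)`: the set of maximizers of `ν ↦ θ t_σ(ν) − D(ν|μ)` over `ℳ`. -/
def Fset {k : ℕ} (σ : Equiv.Perm (Fin k)) (μ : Measure Ω2) (θ : ℝ) :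
    Set (ProbabilityMeasure Ω2) :=
  {ν | ν ∈ Mcal ∧
    (((θ * tPat σ (ν : Measure Ω2) : ℝ) : EReal) - ((KL (↑ν) μ : ℝ≥0∞) : EReal)) = Fsup σ μ θ}

/-- `G(σ,μ,δ) = inf { D(ν|μ) : ν ∈ ℳ, t_σ(ν) ≥ δ }`. -/
def Gfun {k : ℕ} (σ : Equiv.Perm (Fin k)) (μ : Measure Ω2) (δ : ℝ) : ℝ≥0∞ :=
  ⨅ ν ∈ {ν : ProbabilityMeasure Ω2 | ν ∈ Mcal ∧ δ ≤ tPat σ (ν : Measure Ω2)}, KL (↑ν) μ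

/-- `𝒢(σ,μ,δ)`: the set of minimizers in the definition of `G(σ,μ,δ)`. -/
def Gset {k : ℕ} (σ : Equiv.Perm (Fin k)) (μ : Measure Ω2) (δ : ℝ) :
    Set (ProbabilityMeasure Ω2) :=
  {ν | (ν ∈ Mcal ∧ δ ≤ tPat σ (ν : Measure Ω2)) ∧ KL (↑ν) μ = Gfun σ μ δ}

/-- `α_σ(μ) = inf {δ : G(σ,μ,δ) = ∞}`. -/
def alphaSig {k : ℕ} (σ : Equiv.Perm (Fin k)) (μ : Measure Ω2) : ℝ :=
  sInf {δ : ℝ | Gfun σ μ δ = ∞}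

/-- `μ` is conditionally constant (CC) with respect to a pattern `σ` of size `k+1`:
the conditional probability `P(π_{X,Y} = σ | (X₁,Y₁))`, which for i.i.d. samples equals
`z ↦ ∫ h_σ(z, w) dμ^{⊗k}(w)`, is `μ`-a.s. equal to a constant `c ∈ [0,1]`. -/
def IsCC {k : ℕ} (σ : Equiv.Perm (Fin (k + 1))) (μ : Measure Ω2) : Prop :=
  ∃ c ∈ Set.Icc (0 : ℝ) 1, ∀ᵐ z ∂μ,
    (∫ w : Fin k → Ω2, hPat σ (Fin.cons z w) ∂pmeas μ k) = c

/-- The inversion pattern `21 ∈ S₂`. -/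
def inv2 : Equiv.Perm (Fin 2) := Equiv.swap 0 1

/-- Lévy–Prokhorov (extended) distance between measures on `ℝ²`. -/
def dLPE (μ ν : Measure Ω2) : ℝ≥0∞ := levyProkhorovEDist μ ν

/-- The topological support of a measure: the points whose every open neighbourhood
has positive measure. -/
def msupport (μ : Measure Ω2) : Set Ω2 :=
  {z | ∀ U : Set Ω2, IsOpen U → z ∈ U → 0 < μ U}

/-- `ξ₁₁`: the law of `(X, 1/2 − X)` with `X ~ Unif[0,1/2]`. -/
def xi11 : Measure Ω2 :=
  ((2 : ℝ≥0∞) • volume.restrict (Set.Icc (0 : ℝ) (1/2))).map fun x => (x, 1/2 - x)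

/-- `ξ₂₂`: the law of `(X, 3/2 − X)` with `X ~ Unif[1/2,1]`. -/
def xi22 : Measure Ω2 :=
  ((2 : ℝ≥0∞) • volume.restrict (Set.Icc (1/2 : ℝ) 1)).map fun x => (x, 3/2 - x)

/-- The permuton `ξ = (ξ₁₁ + ξ₂₂)/2`. -/
def xiM : Measure Ω2 := (2⁻¹ : ℝ≥0∞) • xi11 + (2⁻¹ : ℝ≥0∞) • xi22

/-- The value of `θ t₂₁ - D(·|ξ)` at the mixture `((1+m)/2) ξ₁₁ + ((1-m)/2) ξ₂₂`. -/
def magnetizedObjective (θ m : ℝ) : ℝ :=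
  θ * ((1 + m ^ 2) / 2)
    - ((1 + m) * Real.log (1 + m) + (1 - m) * Real.log (1 - m)) / 2

/-- The derivative of `magnetizedObjective θ` on `(-1, 1)`. -/
def magnetizedSlope (θ m : ℝ) : ℝ :=
  θ * m - (Real.log (1 + m) - Real.log (1 - m)) / 2

lemma magnetizedObjective_neg (θ m : ℝ) :
    magnetizedObjective θ (-m) = magnetizedObjective θ m := by
  simp only [magnetizedObjective, sub_neg_eq_add, ← sub_eq_add_neg, neg_sq]
  ring

lemma magnetizedObjective_abs (θ m : ℝ) :
    magnetizedObjective θ |m| = magnetizedObjective θ m := by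
  rcases abs_choice m with h | h <;> simp [h, magnetizedObjective_neg]

lemma continuous_magnetizedObjective (θ : ℝ) : Continuous (magnetizedObjective θ) := by
  unfold magnetizedObjective
  have h₁ : Continuous fun m : ℝ => (1 + m) * Real.log (1 + m) :=
    Real.continuous_mul_log.comp (continuous_const.add continuous_id)
  have h₂ : Continuous fun m : ℝ => (1 - m) * Real.log (1 - m) :=
    Real.continuous_mul_log.comp (continuous_const.sub continuous_id)
  fun_prop

lemma hasDerivAt_magnetizedObjective (θ : ℝ) {m : ℝ} (h₁ : -1 < m) (h₂ : m < 1) :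
    HasDerivAt (magnetizedObjective θ) (magnetizedSlope θ m) m := by
  have hp : HasDerivAt (fun m : ℝ => (1 + m) * Real.log (1 + m)) ((Real.log (1 + m) + 1) * 1) m :=
    (Real.hasDerivAt_mul_log (by linarith : 1 + m ≠ 0)).comp m ((hasDerivAt_id m).const_add 1)
  have hm : HasDerivAt (fun m : ℝ => (1 - m) * Real.log (1 - m)) ((Real.log (1 - m) + 1) * -1) m :=
    (Real.hasDerivAt_mul_log (by linarith : 1 - m ≠ 0)).comp m ((hasDerivAt_id m).const_sub 1)
  have hq : HasDerivAt (fun m : ℝ => θ * ((1 + m ^ 2) / 2)) (θ * ((2 * m) / 2)) m := by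
    simpa using ((((hasDerivAt_id m).pow 2).const_add 1).div_const 2).const_mul θ
  refine (hq.sub ((hp.add hm).div_const 2)).congr_deriv ?_
  simp only [magnetizedSlope]
  ring

lemma hasDerivAt_magnetizedSlope (θ : ℝ) {m : ℝ} (h₁ : -1 < m) (h₂ : m < 1) :
    HasDerivAt (magnetizedSlope θ) (θ - 1 / (1 - m ^ 2)) m := by
  have hp := ((hasDerivAt_id m).const_add 1).log (by simp; linarith)
  have hm := ((hasDerivAt_id m).const_sub 1).log (by simp; linarith)
  refine (((hasDerivAt_id m).const_mul θ).sub ((hp.sub hm).div_const 2)).congr_deriv ?_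
  have e₁ : 1 + m ≠ 0 := by linarith
  have e₂ : 1 - m ≠ 0 := by linarith
  have e₃ : 1 - m ^ 2 ≠ 0 := by
    rw [show 1 - m ^ 2 = (1 + m) * (1 - m) by ring]; exact mul_ne_zero e₁ e₂
  simp only [id]
  field_simp
  ring

lemma continuousOn_magnetizedSlope (θ : ℝ) :
    ContinuousOn (magnetizedSlope θ) (Set.Ico 0 1) := fun m hm =>
  (hasDerivAt_magnetizedSlope θ (by linarith [hm.1]) hm.2).continuousAt.continuousWithinAt

lemma magnetizedSlope_zero (θ : ℝ) : magnetizedSlope θ 0 = 0 := by simp [magnetizedSlope]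

lemma strictConcaveOn_magnetizedSlope (θ : ℝ) :
    StrictConcaveOn ℝ (Set.Ico 0 1) (magnetizedSlope θ) := by
  refine StrictAntiOn.strictConcaveOn_of_deriv (convex_Ico 0 1)
    (continuousOn_magnetizedSlope θ) ?_
  rw [interior_Ico]
  intro x hx y hy hxy
  rw [(hasDerivAt_magnetizedSlope θ (by linarith [hx.1]) hx.2).deriv,
    (hasDerivAt_magnetizedSlope θ (by linarith [hy.1]) hy.2).deriv]
  have hx2 : x ^ 2 < y ^ 2 := by nlinarith [hx.1, hx.2, hy.1, hy.2]
  have hy2 : 0 < 1 - y ^ 2 := by nlinarith [hx.1, hx.2, hy.1, hy.2]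
  have := one_div_lt_one_div_of_lt hy2 (by linarith : 1 - y ^ 2 < 1 - x ^ 2)
  linarith

lemma magnetizedSlope_neg_of_le_one {θ m : ℝ} (hθ : θ ≤ 1) (h₀ : 0 < m) (h₁ : m < 1) :
    magnetizedSlope θ m < 0 := by
  have hanti : StrictAntiOn (magnetizedSlope θ) (Set.Ico 0 1) := by
    refine strictAntiOn_of_deriv_neg (convex_Ico 0 1) (continuousOn_magnetizedSlope θ) ?_
    rw [interior_Ico]
    intro x hx
    rw [(hasDerivAt_magnetizedSlope θ (by linarith [hx.1]) hx.2).deriv]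
    have hx2 : 0 < 1 - x ^ 2 := by nlinarith [hx.1, hx.2]
    have : 1 < 1 / (1 - x ^ 2) := by
      rw [lt_div_iff₀ hx2]; nlinarith [hx.1]
    linarith
  have := hanti (Set.left_mem_Ico.2 zero_lt_one) ⟨h₀.le, h₁⟩ h₀
  rwa [magnetizedSlope_zero] at this

lemma magnetizedSlope_pos_of_lt_root {θ r m : ℝ} (hr : r < 1) (hroot : magnetizedSlope θ r = 0)
    (h₀ : 0 < m) (h₁ : m < r) : 0 < magnetizedSlope θ m := by
  have h := (strictConcaveOn_magnetizedSlope θ).2 (Set.left_mem_Ico.2 zero_lt_one)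
    (show r ∈ Set.Ico (0 : ℝ) 1 from ⟨(h₀.trans h₁).le, hr⟩) (h₀.trans h₁).ne
    (show 0 < 1 - m / r by rw [sub_pos, div_lt_one (h₀.trans h₁)]; exact h₁)
    (div_pos h₀ (h₀.trans h₁)) (by ring)
  have e : m / r * r = m := div_mul_cancel₀ _ (h₀.trans h₁).ne'
  simpa [magnetizedSlope_zero, hroot, e] using h

lemma magnetizedSlope_neg_of_root_lt {θ r m : ℝ} (hr : 0 < r) (hroot : magnetizedSlope θ r = 0)
    (h₁ : r < m) (hm : m < 1) : magnetizedSlope θ m < 0 := by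
  by_contra! hcon
  have h := (strictConcaveOn_magnetizedSlope θ).2 (Set.left_mem_Ico.2 zero_lt_one)
    (show m ∈ Set.Ico (0 : ℝ) 1 from ⟨(hr.trans h₁).le, hm⟩) (hr.trans h₁).ne
    (show 0 < 1 - r / m by rw [sub_pos, div_lt_one (hr.trans h₁)]; exact h₁)
    (div_pos hr (hr.trans h₁)) (by ring)
  have e : r / m * m = r := div_mul_cancel₀ _ (hr.trans h₁).ne'
  simp only [magnetizedSlope_zero, smul_eq_mul, mul_zero, zero_add, e, hroot] at h
  have := mul_nonneg (div_pos hr (hr.trans h₁)).le hcon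
  linarith

lemma eq_tanh_iff_magnetizedSlope_eq_zero {θ m : ℝ} (h₁ : -1 < m) (h₂ : m < 1) :
    m = Real.tanh (θ * m) ↔ magnetizedSlope θ m = 0 := by
  have hlog : magnetizedSlope θ m = θ * m - Real.artanh m := by
    rw [Real.artanh_eq_half_log ⟨h₁.le, h₂.le⟩,
      Real.log_div (by linarith) (by linarith), magnetizedSlope]
    ring
  rw [hlog, sub_eq_zero]
  constructor
  · intro h
    rw [← Real.artanh_tanh (θ * m), ← h]
  · intro h
    rw [h, Real.tanh_artanh ⟨h₁, h₂⟩]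

lemma lt_one_of_eq_tanh {θ m : ℝ} (h : m = Real.tanh (θ * m)) : m < 1 :=
  h.trans_lt (Real.tanh_lt_one _)

lemma magnetizedSlope_eq_zero_of_eq_tanh {θ m : ℝ} (h₀ : 0 < m) (h : m = Real.tanh (θ * m)) :
    magnetizedSlope θ m = 0 :=
  (eq_tanh_iff_magnetizedSlope_eq_zero (by linarith) (lt_one_of_eq_tanh h)).1 h

lemma existsUnique_pos_eq_tanh {θ : ℝ} (hθ : 1 < θ) :
    ∃! m : ℝ, 0 < m ∧ m = Real.tanh (θ * m) := by
  obtain ⟨a, ⟨ha₀, ha₁⟩, ha⟩ : ∃ a ∈ Set.Ioo (0 : ℝ) 1, 0 < magnetizedSlope θ a := by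
    have hd := hasDerivAt_magnetizedSlope θ (m := 0) (by norm_num) (by norm_num)
    have hpos := hasDerivWithinAt_iff_tendsto_slope.1 (hd.hasDerivWithinAt (s := Set.Ioi 0))
    have hev : ∀ᶠ x in 𝓝[>] (0 : ℝ), 0 < slope (magnetizedSlope θ) 0 x := by
      rw [Set.sdiff_singleton_eq_self (by simp)] at hpos
      exact hpos.eventually (lt_mem_nhds (by norm_num; linarith))
    obtain ⟨a, ha, ha'⟩ := (hev.and (Ioo_mem_nhdsGT zero_lt_one)).exists
    refine ⟨a, ha', ?_⟩
    rw [slope_def_field, magnetizedSlope_zero, sub_zero, sub_zero] at ha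
    exact (div_pos_iff_of_pos_right ha'.1).1 ha
  have hroot : ∃ m ∈ Set.Icc a 1, Real.tanh (θ * m) - m = 0 := by
    have hc : ContinuousOn (fun m => Real.tanh (θ * m) - m) (Set.Icc a 1) := by
      have : Continuous Real.tanh := by
        simp only [funext Real.tanh_eq_sinh_div_cosh]
        exact Real.continuous_sinh.div Real.continuous_cosh fun x => (Real.cosh_pos x).ne'
      fun_prop
    refine intermediate_value_Icc' ha₁.le hc ⟨by linarith [Real.tanh_lt_one (θ * 1)], ?_⟩
    by_contra! hcon
    have hlt : Real.artanh (Real.tanh (θ * a)) < Real.artanh a := by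
      exact Real.artanh_lt_artanh (Real.neg_one_lt_tanh _) ha₁ (by linarith)
    rw [Real.artanh_tanh, Real.artanh_eq_half_log ⟨by linarith, ha₁.le⟩,
      Real.log_div (by linarith) (by linarith)] at hlt
    simp only [magnetizedSlope] at ha
    linarith
  obtain ⟨m, hm, hm0⟩ := hroot
  refine ⟨m, ⟨ha₀.trans_le hm.1, by linarith⟩, ?_⟩
  rintro s ⟨hs₀, hs⟩
  have hm₀ := ha₀.trans_le hm.1
  have hm' : m = Real.tanh (θ * m) := by linarith
  have es := magnetizedSlope_eq_zero_of_eq_tanh hs₀ hs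
  have em := magnetizedSlope_eq_zero_of_eq_tanh hm₀ hm'
  rcases lt_trichotomy s m with h | h | h
  · exact absurd em (magnetizedSlope_neg_of_root_lt hs₀ es h (lt_one_of_eq_tanh hm')).ne
  · exact h
  · exact absurd es (magnetizedSlope_neg_of_root_lt hm₀ em h (lt_one_of_eq_tanh hs)).ne

lemma magnetizedObjective_lt_of_le_one {θ m : ℝ} (hθ : θ ≤ 1) (hm : |m| ≤ 1) (h₀ : m ≠ 0) :
    magnetizedObjective θ m < magnetizedObjective θ 0 := by
  have hanti : StrictAntiOn (magnetizedObjective θ) (Set.Icc 0 1) := by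
    refine strictAntiOn_of_deriv_neg (convex_Icc 0 1)
      (continuous_magnetizedObjective θ).continuousOn ?_
    rw [interior_Icc]
    intro x hx
    rw [(hasDerivAt_magnetizedObjective θ (by linarith [hx.1]) hx.2).deriv]
    exact magnetizedSlope_neg_of_le_one hθ hx.1 hx.2
  rw [← magnetizedObjective_abs θ m]
  exact hanti (Set.left_mem_Icc.2 zero_le_one) ⟨abs_nonneg m, hm⟩ (abs_pos.2 h₀)

lemma magnetizedObjective_lt_root {θ r m : ℝ} (hr : 0 < r) (hroot : r = Real.tanh (θ * r))
    (hm : |m| ≤ 1) (h : |m| ≠ r) :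
    magnetizedObjective θ m < magnetizedObjective θ r := by
  have hr₁ := lt_one_of_eq_tanh hroot
  have hs := magnetizedSlope_eq_zero_of_eq_tanh hr hroot
  rw [← magnetizedObjective_abs θ m]
  rcases lt_or_gt_of_ne h with h | h
  · have hmono : StrictMonoOn (magnetizedObjective θ) (Set.Icc 0 r) := by
      refine strictMonoOn_of_deriv_pos (convex_Icc 0 r)
        (continuous_magnetizedObjective θ).continuousOn ?_
      rw [interior_Icc]
      intro x hx
      rw [(hasDerivAt_magnetizedObjective θ (by linarith [hx.1]) (hx.2.trans hr₁)).deriv]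
      exact magnetizedSlope_pos_of_lt_root hr₁ hs hx.1 hx.2
    exact hmono ⟨abs_nonneg m, h.le⟩ (Set.right_mem_Icc.2 hr.le) h
  · have hanti : StrictAntiOn (magnetizedObjective θ) (Set.Icc r 1) := by
      refine strictAntiOn_of_deriv_neg (convex_Icc r 1)
        (continuous_magnetizedObjective θ).continuousOn ?_
      rw [interior_Icc]
      intro x hx
      rw [(hasDerivAt_magnetizedObjective θ (by linarith [hx.1]) hx.2).deriv]
      exact magnetizedSlope_neg_of_root_lt hr hs hx.1 hx.2
    exact hanti (Set.left_mem_Icc.2 hr₁.le) ⟨h.le, hm⟩ h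

/-- The left half of the plane, which carries `ξ₁₁` and is `ξ₂₂`-null. -/
def leftHalf : Set Ω2 := {z | z.1 < 1 / 2}

lemma measurableSet_leftHalf : MeasurableSet leftHalf :=
  measurableSet_lt measurable_fst measurable_const

/-- The union of the two antidiagonal segments carrying `ξ`. -/
def xiSegments : Set Ω2 :=
  {z | (z ∈ leftHalf ∧ 0 ≤ z.1 ∧ z.2 = 1 / 2 - z.1) ∨
    (z ∉ leftHalf ∧ z.1 ≤ 1 ∧ z.2 = 3 / 2 - z.1)}

instance isProbabilityMeasure_xi11 : IsProbabilityMeasure xi11 := by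
  refine ⟨?_⟩
  rw [xi11, Measure.map_apply (by fun_prop) MeasurableSet.univ]
  simp only [Set.preimage_univ, Measure.smul_apply, Measure.restrict_apply_univ, Real.volume_Icc,
    smul_eq_mul]
  rw [show (2 : ℝ≥0∞) = ENNReal.ofReal 2 by simp, ← ENNReal.ofReal_mul (by norm_num)]
  norm_num

instance isProbabilityMeasure_xi22 : IsProbabilityMeasure xi22 := by
  refine ⟨?_⟩
  rw [xi22, Measure.map_apply (by fun_prop) MeasurableSet.univ]
  simp only [Set.preimage_univ, Measure.smul_apply, Measure.restrict_apply_univ, Real.volume_Icc,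
    smul_eq_mul]
  rw [show (2 : ℝ≥0∞) = ENNReal.ofReal 2 by simp, ← ENNReal.ofReal_mul (by norm_num)]
  norm_num

instance isProbabilityMeasure_xiM : IsProbabilityMeasure xiM := by
  refine ⟨?_⟩
  simp [xiM, ENNReal.inv_two_add_inv_two]

lemma ae_xi11_fst_ne (x : ℝ) : ∀ᵐ z ∂xi11, z.1 ≠ x := by
  rw [xi11]
  refine (ae_map_iff (p := fun z : Ω2 => z.1 ≠ x) (by fun_prop)
    (measurableSet_eq_fun measurable_fst measurable_const).compl).2 ?_
  exact Measure.ae_smul_measure (ae_restrict_of_ae (Measure.ae_ne volume x)) 2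

lemma ae_xi22_fst_ne (x : ℝ) : ∀ᵐ z ∂xi22, z.1 ≠ x := by
  rw [xi22]
  refine (ae_map_iff (p := fun z : Ω2 => z.1 ≠ x) (by fun_prop)
    (measurableSet_eq_fun measurable_fst measurable_const).compl).2 ?_
  exact Measure.ae_smul_measure (ae_restrict_of_ae (Measure.ae_ne volume x)) 2

lemma ae_xi11_mem : ∀ᵐ z ∂xi11, z ∈ leftHalf ∧ 0 ≤ z.1 ∧ z.2 = 1 / 2 - z.1 := by
  have h : ∀ᵐ z ∂xi11, z.1 ≤ 1 / 2 ∧ 0 ≤ z.1 ∧ z.2 = 1 / 2 - z.1 := by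
    rw [xi11, ae_map_iff (by fun_prop) (by measurability)]
    refine Measure.ae_smul_measure ?_ 2
    filter_upwards [ae_restrict_mem measurableSet_Icc] with x hx
    exact ⟨hx.2, hx.1, rfl⟩
  filter_upwards [h, ae_xi11_fst_ne (1 / 2)] with z hz hz'
  exact ⟨lt_of_le_of_ne hz.1 hz', hz.2⟩

lemma ae_xi22_mem : ∀ᵐ z ∂xi22, z ∉ leftHalf ∧ z.1 ≤ 1 ∧ z.2 = 3 / 2 - z.1 := by
  have h : ∀ᵐ z ∂xi22, 1 / 2 ≤ z.1 ∧ z.1 ≤ 1 ∧ z.2 = 3 / 2 - z.1 := by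
    rw [xi22, ae_map_iff (by fun_prop) (by measurability)]
    refine Measure.ae_smul_measure ?_ 2
    filter_upwards [ae_restrict_mem measurableSet_Icc] with x hx
    exact ⟨hx.1, hx.2, rfl⟩
  filter_upwards [h] with z hz
  exact ⟨hz.1.not_gt, hz.2⟩

lemma ae_xiM_of_ae {P : Ω2 → Prop} (h₁ : ∀ᵐ z ∂xi11, P z) (h₂ : ∀ᵐ z ∂xi22, P z) :
    ∀ᵐ z ∂xiM, P z := by
  rw [xiM, ae_add_measure_iff]
  exact ⟨Measure.ae_smul_measure h₁ _, Measure.ae_smul_measure h₂ _⟩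

lemma ae_xiM_mem : ∀ᵐ z ∂xiM, z ∈ xiSegments :=
  ae_xiM_of_ae (ae_xi11_mem.mono fun _ h => Or.inl h) (ae_xi22_mem.mono fun _ h => Or.inr h)

lemma ae_xiM_fst_ne (x : ℝ) : ∀ᵐ z ∂xiM, z.1 ≠ x :=
  ae_xiM_of_ae (ae_xi11_fst_ne x) (ae_xi22_fst_ne x)

lemma ae_xiM_snd_ne (y : ℝ) : ∀ᵐ z ∂xiM, z.2 ≠ y := by
  filter_upwards [ae_xiM_mem, ae_xiM_fst_ne (1 / 2 - y), ae_xiM_fst_ne (3 / 2 - y)]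
    with z hz h₁ h₂ h
  rcases hz with ⟨-, -, hz⟩ | ⟨-, -, hz⟩
  · exact h₁ (by linarith)
  · exact h₂ (by linarith)

lemma xi11_leftHalf : xi11 leftHalf = 1 :=
  (mem_ae_iff_prob_eq_one measurableSet_leftHalf).1 (ae_xi11_mem.mono fun _ h => h.1)

lemma xi22_leftHalf : xi22 leftHalf = 0 :=
  measure_eq_zero_iff_ae_notMem.2 (ae_xi22_mem.mono fun _ h => h.1)

lemma xiM_restrict_leftHalf : xiM.restrict leftHalf = (2⁻¹ : ℝ≥0∞) • xi11 := by
  have h₁ : xi11.restrict leftHalf = xi11 :=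
    Measure.restrict_eq_self_of_ae_mem (ae_xi11_mem.mono fun _ h => h.1)
  have h₂ : xi22.restrict leftHalf = 0 := Measure.restrict_eq_zero.2 xi22_leftHalf
  simp [xiM, Measure.restrict_add, Measure.restrict_smul, h₁, h₂]

lemma xiM_restrict_compl_leftHalf : xiM.restrict leftHalfᶜ = (2⁻¹ : ℝ≥0∞) • xi22 := by
  have h₁ : xi11.restrict leftHalfᶜ = 0 := by
    rw [Measure.restrict_eq_zero, prob_compl_eq_zero_iff measurableSet_leftHalf, xi11_leftHalf]
  have h₂ : xi22.restrict leftHalfᶜ = xi22 :=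
    Measure.restrict_eq_self_of_ae_mem (ae_xi22_mem.mono fun _ h => h.1)
  simp [xiM, Measure.restrict_add, Measure.restrict_smul, h₁, h₂]

lemma mem_Mcal_of_absolutelyContinuous {ν : ProbabilityMeasure Ω2}
    (h : (ν : Measure Ω2) ≪ xiM) : ν ∈ Mcal := by
  refine ⟨?_, fun x => ?_, fun y => ?_⟩
  · refine (mem_ae_iff_prob_eq_one (measurableSet_Icc.prod measurableSet_Icc)).1
      (h.ae_le (ae_xiM_mem.mono fun z hz => ?_))
    change z ∈ unitSq
    rw [unitSq, Set.mem_prod, Set.mem_Icc, Set.mem_Icc]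
    rcases hz with ⟨h₁, h₂, h₃⟩ | ⟨h₁, h₂, h₃⟩
    · have : z.1 < 1 / 2 := h₁
      refine ⟨⟨?_, ?_⟩, ?_, ?_⟩ <;> linarith
    · have : 1 / 2 ≤ z.1 := not_lt.1 h₁
      refine ⟨⟨?_, ?_⟩, ?_, ?_⟩ <;> linarith
  · rw [Measure.map_apply measurable_fst (measurableSet_singleton x)]
    exact measure_eq_zero_iff_ae_notMem.2 (h.ae_le (ae_xiM_fst_ne x))
  · rw [Measure.map_apply measurable_snd (measurableSet_singleton y)]
    exact measure_eq_zero_iff_ae_notMem.2 (h.ae_le (ae_xiM_snd_ne y))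

lemma hPat_inv2 (z : Fin 2 → Ω2) :
    hPat inv2 z = if ((z 0).1 < (z 1).1 ∧ (z 1).2 < (z 0).2) ∨
      ((z 1).1 < (z 0).1 ∧ (z 0).2 < (z 1).2) then 1 else 0 := by
  have key : (∃ τ : Equiv.Perm (Fin 2), StrictMono (fun i => (z (τ i)).1) ∧
      StrictMono (fun i => (z (τ (inv2⁻¹ i))).2)) ↔
      ((z 0).1 < (z 1).1 ∧ (z 1).2 < (z 0).2) ∨ ((z 1).1 < (z 0).1 ∧ (z 0).2 < (z 1).2) := by
    have hperm : ∀ τ : Equiv.Perm (Fin 2), τ = 1 ∨ τ = Equiv.swap 0 1 := by decide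
    simp only [Fin.strictMono_iff_lt_succ, Fin.forall_fin_one, inv2, Equiv.swap_inv]
    constructor
    · rintro ⟨τ, h₁, h₂⟩
      have : τ = 1 ∨ τ = Equiv.swap 0 1 := hperm τ
      rcases this with rfl | rfl
      · left; simpa using ⟨h₁, h₂⟩
      · right; simpa using ⟨h₁, h₂⟩
    · rintro (h | h)
      · exact ⟨1, by simpa using h⟩
      · exact ⟨Equiv.swap 0 1, by simpa using h⟩
  simp only [hPat, key]

lemma hPat_inv2_of_mem_xiSegments {z : Fin 2 → Ω2} (h₀ : z 0 ∈ xiSegments)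
    (h₁ : z 1 ∈ xiSegments) (hne : (z 0).1 ≠ (z 1).1) :
    hPat inv2 z = ((Set.univ.pi fun _ => leftHalf) ∪ (Set.univ.pi fun _ => leftHalfᶜ)).indicator
      (fun _ : Fin 2 → Ω2 => (1 : ℝ)) z := by
  classical
  rw [hPat_inv2, Set.indicator_apply]
  refine if_congr ?_ rfl rfl
  rw [Set.mem_union, Set.mem_univ_pi, Set.mem_univ_pi, Fin.forall_fin_two, Fin.forall_fin_two,
    Set.mem_compl_iff, Set.mem_compl_iff]
  rcases h₀ with ⟨a, a', ha⟩ | ⟨a, a', ha⟩ <;> rcases h₁ with ⟨b, b', hb⟩ | ⟨b, b', hb⟩ <;>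
    simp only [leftHalf, Set.mem_ofPred_eq, not_lt] at a b ⊢ <;>
    simp only [ha, hb] <;> grind

lemma tPat_inv2 {ν : Measure Ω2} [IsProbabilityMeasure ν] (h : ν ≪ xiM) :
    tPat inv2 ν = ν.real leftHalf ^ 2 + (1 - ν.real leftHalf) ^ 2 := by
  have hmem (i : Fin 2) : ∀ᵐ z ∂(Measure.pi fun _ : Fin 2 => ν), z i ∈ xiSegments :=
    (measurePreserving_eval (fun _ : Fin 2 => ν) i).quasiMeasurePreserving.ae
      (h.ae_le ae_xiM_mem)
  have hne : ∀ᵐ z ∂(Measure.pi fun _ : Fin 2 => ν), (z 0).1 ≠ (z 1).1 := by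
    have hprod : ∀ᵐ w ∂(ν.prod ν), w.1.1 ≠ w.2.1 := by
      have hms : MeasurableSet {w : Ω2 × Ω2 | w.1.1 ≠ w.2.1} :=
        (measurableSet_eq_fun (by fun_prop) (by fun_prop)).compl
      rw [Measure.ae_prod_iff_ae_ae hms]
      exact Eventually.of_forall fun w =>
        ((ae_xiM_fst_ne w.1).filter_mono h.ae_le).mono fun _ h => h.symm
    exact (measurePreserving_finTwoArrow ν).quasiMeasurePreserving.ae hprod
  have hL : MeasurableSet (Set.univ.pi fun _ : Fin 2 => leftHalf) :=
    MeasurableSet.univ_pi fun _ => measurableSet_leftHalf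
  have hR : MeasurableSet (Set.univ.pi fun _ : Fin 2 => leftHalfᶜ) :=
    MeasurableSet.univ_pi fun _ => measurableSet_leftHalf.compl
  have hae : hPat inv2 =ᵐ[Measure.pi fun _ : Fin 2 => ν]
      ((Set.univ.pi fun _ => leftHalf) ∪ (Set.univ.pi fun _ => leftHalfᶜ)).indicator
        (fun _ : Fin 2 → Ω2 => (1 : ℝ)) := by
    filter_upwards [hmem 0, hmem 1, hne] with z h₀ h₁ hz
    exact hPat_inv2_of_mem_xiSegments h₀ h₁ hz
  have hdisj : Disjoint (Set.univ.pi fun _ : Fin 2 => leftHalf)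
      (Set.univ.pi fun _ : Fin 2 => leftHalfᶜ) :=
    Set.disjoint_left.2 fun z hz hz' => hz' 0 trivial (hz 0 trivial)
  rw [tPat, integral_congr_ae hae, integral_indicator_const _ (hL.union hR), smul_eq_mul, mul_one,
    measureReal_union hdisj hR]
  simp only [Measure.real, Measure.pi_pi, Fin.prod_univ_two, ENNReal.toReal_mul]
  rw [← Measure.real, ← Measure.real, probReal_compl_eq_one_sub measurableSet_leftHalf]
  ring

/-- The mixture `p ξ₁₁ + (1-p) ξ₂₂`. -/
def xiMix (p : ℝ) : Measure Ω2 := ENNReal.ofReal p • xi11 + ENNReal.ofReal (1 - p) • xi22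

lemma isProbabilityMeasure_xiMix {p : ℝ} (hp : p ∈ Set.Icc (0 : ℝ) 1) :
    IsProbabilityMeasure (xiMix p) := by
  refine ⟨?_⟩
  simp only [xiMix, Measure.add_apply, Measure.smul_apply, measure_univ, smul_eq_mul, mul_one]
  rw [← ENNReal.ofReal_add hp.1 (sub_nonneg.2 hp.2)]
  simp

lemma xiMix_half : xiMix (1 / 2) = xiM := by
  rw [xiMix, xiM, show (1 : ℝ) - 1 / 2 = 1 / 2 by norm_num,
    show ENNReal.ofReal (1 / 2) = 2⁻¹ by
      rw [one_div, ENNReal.ofReal_inv_of_pos two_pos, ENNReal.ofReal_ofNat]]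

lemma xiMix_apply_leftHalf (p : ℝ) : xiMix p leftHalf = ENNReal.ofReal p := by
  simp [xiMix, xi11_leftHalf, xi22_leftHalf]

lemma xiMix_real_leftHalf {p : ℝ} (hp : 0 ≤ p) : (xiMix p).real leftHalf = p := by
  rw [Measure.real, xiMix_apply_leftHalf, ENNReal.toReal_ofReal hp]

/-- The density of `xiMix p` with respect to `ξ`. -/
def xiMixDensity (p : ℝ) : Ω2 → ℝ≥0∞ :=
  leftHalf.indicator (fun _ => ENNReal.ofReal (2 * p)) +
    leftHalfᶜ.indicator (fun _ => ENNReal.ofReal (2 * (1 - p)))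

lemma xiMixDensity_of_mem {p : ℝ} {z : Ω2} (hz : z ∈ leftHalf) :
    xiMixDensity p z = ENNReal.ofReal (2 * p) := by
  simp [xiMixDensity, hz]

lemma xiMixDensity_of_notMem {p : ℝ} {z : Ω2} (hz : z ∉ leftHalf) :
    xiMixDensity p z = ENNReal.ofReal (2 * (1 - p)) := by
  simp [xiMixDensity, hz]

lemma measurable_xiMixDensity (p : ℝ) : Measurable (xiMixDensity p) :=
  (measurable_const.indicator measurableSet_leftHalf).add
    (measurable_const.indicator measurableSet_leftHalf.compl)

lemma xiM_withDensity_xiMixDensity (p : ℝ) : xiM.withDensity (xiMixDensity p) = xiMix p := by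
  have h (x : ℝ) : ENNReal.ofReal (2 * x) * 2⁻¹ = ENNReal.ofReal x := by
    rw [ENNReal.ofReal_mul two_pos.le, ENNReal.ofReal_ofNat, mul_comm, ← mul_assoc,
      ENNReal.inv_mul_cancel two_ne_zero ENNReal.ofNat_ne_top, one_mul]
  rw [xiMixDensity,
    withDensity_add_left (measurable_const.indicator measurableSet_leftHalf),
    withDensity_indicator measurableSet_leftHalf,
    withDensity_indicator measurableSet_leftHalf.compl, withDensity_const, withDensity_const,
    xiM_restrict_leftHalf, xiM_restrict_compl_leftHalf, smul_smul, smul_smul, h, h, xiMix]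

lemma xiMix_absolutelyContinuous (p : ℝ) : xiMix p ≪ xiM := by
  rw [← xiM_withDensity_xiMixDensity]
  exact withDensity_absolutelyContinuous _ _

/-- The relative entropy of `xiMix p` with respect to `ξ`. -/
def xiMixEntropy (p : ℝ) : ℝ :=
  (InformationTheory.klFun (2 * p) + InformationTheory.klFun (2 * (1 - p))) / 2

lemma xiMixEntropy_nonneg {p : ℝ} (hp : p ∈ Set.Icc (0 : ℝ) 1) : 0 ≤ xiMixEntropy p :=
  div_nonneg (add_nonneg (InformationTheory.klFun_nonneg (by linarith [hp.1]))
    (InformationTheory.klFun_nonneg (by linarith [hp.2]))) two_pos.le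

lemma lintegral_xiM (F : Ω2 → ℝ≥0∞) :
    ∫⁻ z, F z ∂xiM = 2⁻¹ * ∫⁻ z, F z ∂xi11 + 2⁻¹ * ∫⁻ z, F z ∂xi22 := by
  simp [xiM, lintegral_add_measure, lintegral_smul_measure]

lemma KL_xiMix {p : ℝ} (hp : p ∈ Set.Icc (0 : ℝ) 1) :
    KL (xiMix p) xiM = ENNReal.ofReal (xiMixEntropy p) := by
  have hd : (xiMix p).rnDeriv xiM =ᵐ[xiM] xiMixDensity p := by
    rw [← xiM_withDensity_xiMixDensity]
    exact Measure.rnDeriv_withDensity _ (measurable_xiMixDensity p)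
  have hp₀ : 0 ≤ 2 * p := by linarith [hp.1]
  have hp₁ : 0 ≤ 2 * (1 - p) := by linarith [hp.2]
  have e (x : ℝ) : x * Real.log x + 1 - x = InformationTheory.klFun x := rfl
  rw [KL, if_pos (xiMix_absolutelyContinuous p),
    lintegral_congr_ae (g := fun z => ENNReal.ofReal
      (InformationTheory.klFun (xiMixDensity p z).toReal))
      (hd.mono fun z hz => by simp only [hz, e]),
    lintegral_xiM,
    lintegral_congr_ae (μ := xi11)
      (g := fun _ => ENNReal.ofReal (InformationTheory.klFun (2 * p)))
      (ae_xi11_mem.mono fun z hz => by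
        simp only [xiMixDensity_of_mem hz.1, ENNReal.toReal_ofReal hp₀]),
    lintegral_congr_ae (μ := xi22)
      (g := fun _ => ENNReal.ofReal (InformationTheory.klFun (2 * (1 - p))))
      (ae_xi22_mem.mono fun z hz => by
        simp only [xiMixDensity_of_notMem hz.1, ENNReal.toReal_ofReal hp₁]),
    lintegral_const, lintegral_const, measure_univ, measure_univ, mul_one, mul_one,
    ← mul_add, ← ENNReal.ofReal_add (InformationTheory.klFun_nonneg hp₀)
      (InformationTheory.klFun_nonneg hp₁), xiMixEntropy, div_eq_inv_mul,
    ENNReal.ofReal_mul (by norm_num), ENNReal.ofReal_inv_of_pos two_pos, ENNReal.ofReal_ofNat]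

lemma integrable_xi11_of_xiM {f : Ω2 → ℝ} (hf : Integrable f xiM) : Integrable f xi11 :=
  (integrable_smul_measure (by simp) (by simp)).1 hf.left_of_add_measure

lemma integrable_xi22_of_xiM {f : Ω2 → ℝ} (hf : Integrable f xiM) : Integrable f xi22 :=
  (integrable_smul_measure (by simp) (by simp)).1 hf.right_of_add_measure

lemma integral_xiM {f : Ω2 → ℝ} (hf : Integrable f xiM) :
    ∫ z, f z ∂xiM = (∫ z, f z ∂xi11 + ∫ z, f z ∂xi22) / 2 := by
  rw [xiM, integral_add_measure hf.left_of_add_measure hf.right_of_add_measure,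
    integral_smul_measure, integral_smul_measure]
  simp only [ENNReal.toReal_inv, ENNReal.toReal_ofNat, smul_eq_mul]
  ring

lemma integral_rnDeriv_xi11 {ν : Measure Ω2} [IsProbabilityMeasure ν] (h : ν ≪ xiM) :
    ∫ z, (ν.rnDeriv xiM z).toReal ∂xi11 = 2 * ν.real leftHalf := by
  have := Measure.setIntegral_toReal_rnDeriv h leftHalf
  rw [xiM_restrict_leftHalf, integral_smul_measure] at this
  simp only [ENNReal.toReal_inv, ENNReal.toReal_ofNat, smul_eq_mul] at this
  linarith

lemma integral_rnDeriv_xi22 {ν : Measure Ω2} [IsProbabilityMeasure ν] (h : ν ≪ xiM) :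
    ∫ z, (ν.rnDeriv xiM z).toReal ∂xi22 = 2 * (1 - ν.real leftHalf) := by
  have := Measure.setIntegral_toReal_rnDeriv h leftHalfᶜ
  rw [xiM_restrict_compl_leftHalf, integral_smul_measure,
    probReal_compl_eq_one_sub measurableSet_leftHalf] at this
  simp only [ENNReal.toReal_inv, ENNReal.toReal_ofNat, smul_eq_mul] at this
  linarith

lemma ae_eq_integral_or_klFun_integral_lt {μ : Measure Ω2} [IsProbabilityMeasure μ] {f : Ω2 → ℝ}
    (h₀ : ∀ z, 0 ≤ f z) (hf : Integrable f μ)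
    (hk : Integrable (fun z => InformationTheory.klFun (f z)) μ) :
    (∀ᵐ z ∂μ, f z = ∫ w, f w ∂μ) ∨
      InformationTheory.klFun (∫ z, f z ∂μ) < ∫ z, InformationTheory.klFun (f z) ∂μ := by
  have h := InformationTheory.strictConvexOn_klFun.ae_eq_const_or_map_average_lt
    InformationTheory.continuous_klFun.continuousOn isClosed_Ici
    (Eventually.of_forall h₀) hf hk
  simp only [average_eq_integral] at h
  exact h

lemma eq_xiMix_or_xiMixEntropy_lt_KL {ν : Measure Ω2} [IsProbabilityMeasure ν] (h : ν ≪ xiM)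
    (hfin : KL ν xiM ≠ ∞) :
    ν = xiMix (ν.real leftHalf) ∨ xiMixEntropy (ν.real leftHalf) < (KL ν xiM).toReal := by
  set p := ν.real leftHalf with hp
  set f : Ω2 → ℝ := fun z => (ν.rnDeriv xiM z).toReal with hf
  have hf₀ (z) : 0 ≤ f z := ENNReal.toReal_nonneg
  have hfm : Measurable f := (Measure.measurable_rnDeriv ν xiM).ennreal_toReal
  have hk₀ (z) : 0 ≤ InformationTheory.klFun (f z) := InformationTheory.klFun_nonneg (hf₀ z)
  have hKL : KL ν xiM = ∫⁻ z, ENNReal.ofReal (InformationTheory.klFun (f z)) ∂xiM := by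
    rw [KL, if_pos h]
    rfl
  have hfi : Integrable f xiM := Measure.integrable_toReal_rnDeriv
  have hkm : AEStronglyMeasurable (fun z => InformationTheory.klFun (f z)) xiM :=
    (InformationTheory.measurable_klFun.comp hfm).aestronglyMeasurable
  have hki : Integrable (fun z => InformationTheory.klFun (f z)) xiM :=
    (lintegral_ofReal_ne_top_iff_integrable hkm (Eventually.of_forall hk₀)).1 (hKL ▸ hfin)
  have hKLr : (KL ν xiM).toReal = (∫ z, InformationTheory.klFun (f z) ∂xi11
      + ∫ z, InformationTheory.klFun (f z) ∂xi22) / 2 := by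
    rw [← integral_xiM hki, hKL, integral_eq_lintegral_of_nonneg_ae (Eventually.of_forall hk₀) hkm]
  have e₁ : ∫ z, f z ∂xi11 = 2 * p := integral_rnDeriv_xi11 h
  have e₂ : ∫ z, f z ∂xi22 = 2 * (1 - p) := integral_rnDeriv_xi22 h
  have h₁ := ae_eq_integral_or_klFun_integral_lt hf₀ (integrable_xi11_of_xiM hfi)
    (integrable_xi11_of_xiM hki)
  have h₂ := ae_eq_integral_or_klFun_integral_lt hf₀ (integrable_xi22_of_xiM hfi)
    (integrable_xi22_of_xiM hki)
  rw [e₁] at h₁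
  rw [e₂] at h₂
  have le_of_ae {μ : Measure Ω2} [IsProbabilityMeasure μ] {c : ℝ} (hc : ∀ᵐ z ∂μ, f z = c) :
      ∫ z, InformationTheory.klFun (f z) ∂μ = InformationTheory.klFun c := by
    rw [integral_congr_ae (g := fun _ => InformationTheory.klFun c)
      (hc.mono fun z hz => by simp only [hz])]
    simp
  rw [hKLr, xiMixEntropy]
  rcases h₁ with h₁ | h₁ <;> rcases h₂ with h₂ | h₂
  · left
    rw [← xiM_withDensity_xiMixDensity, ← Measure.withDensity_rnDeriv_eq ν xiM h]
    refine withDensity_congr_ae ?_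
    have hlt := Measure.rnDeriv_lt_top ν xiM
    have hae : ∀ᵐ z ∂xiM, ENNReal.ofReal (f z) = xiMixDensity p z := by
      refine ae_xiM_of_ae ?_ ?_
      · filter_upwards [h₁, ae_xi11_mem] with z hz hz'
        rw [hz, xiMixDensity_of_mem hz'.1]
      · filter_upwards [h₂, ae_xi22_mem] with z hz hz'
        rw [hz, xiMixDensity_of_notMem hz'.1]
    filter_upwards [hlt, hae] with z hz hz'
    rw [← hz', ENNReal.ofReal_toReal hz.ne]
  all_goals right
  · linarith [le_of_ae h₁]
  · linarith [le_of_ae h₂]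
  · linarith

lemma sq_add_sq_sub_xiMixEntropy (θ p : ℝ) :
    θ * (p ^ 2 + (1 - p) ^ 2) - xiMixEntropy p = magnetizedObjective θ (2 * p - 1) := by
  simp only [xiMixEntropy, magnetizedObjective, InformationTheory.klFun_apply]
  rw [show 1 + (2 * p - 1) = 2 * p by ring, show 1 - (2 * p - 1) = 2 * (1 - p) by ring]
  ring

lemma objective_xiMix (θ : ℝ) {p : ℝ} (hp : p ∈ Set.Icc (0 : ℝ) 1) :
    ((θ * tPat inv2 (xiMix p) : ℝ) : EReal) - ((KL (xiMix p) xiM : ℝ≥0∞) : EReal)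
      = (magnetizedObjective θ (2 * p - 1) : ℝ) := by
  have := isProbabilityMeasure_xiMix hp
  rw [tPat_inv2 (xiMix_absolutelyContinuous p), xiMix_real_leftHalf hp.1, KL_xiMix hp,
    EReal.coe_ennreal_ofReal, max_eq_left (xiMixEntropy_nonneg hp), ← EReal.coe_sub,
    sq_add_sq_sub_xiMixEntropy]

lemma eq_xiMix_or_objective_lt (θ : ℝ) (ν : Measure Ω2) [IsProbabilityMeasure ν] :
    ∃ p ∈ Set.Icc (0 : ℝ) 1, ν = xiMix p ∨
      ((θ * tPat inv2 ν : ℝ) : EReal) - ((KL ν xiM : ℝ≥0∞) : EReal)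
        < (magnetizedObjective θ (2 * p - 1) : ℝ) := by
  refine ⟨ν.real leftHalf, ⟨measureReal_nonneg, measureReal_le_one⟩, ?_⟩
  by_cases hfin : KL ν xiM = ∞
  · right
    rw [hfin, EReal.coe_ennreal_top, EReal.sub_top]
    exact EReal.bot_lt_coe _
  · have h : ν ≪ xiM := by
      by_contra h
      exact hfin (if_neg h)
    refine (eq_xiMix_or_xiMixEntropy_lt_KL h hfin).imp id fun hlt => ?_
    rw [← EReal.coe_ennreal_toReal hfin, ← EReal.coe_sub, EReal.coe_lt_coe_iff, tPat_inv2 h,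
      ← sq_add_sq_sub_xiMixEntropy]
    linarith

lemma Fset_inv2_xiM {θ : ℝ} {q : ℝ} (hq : q ∈ Set.Icc (0 : ℝ) 1)
    (hmax : ∀ p ∈ Set.Icc (0 : ℝ) 1,
      magnetizedObjective θ (2 * p - 1) ≤ magnetizedObjective θ (2 * q - 1)) :
    Fset inv2 xiM θ = {ν : ProbabilityMeasure Ω2 | ∃ p ∈ Set.Icc (0 : ℝ) 1,
      magnetizedObjective θ (2 * p - 1) = magnetizedObjective θ (2 * q - 1) ∧
        (ν : Measure Ω2) = xiMix p} := by
  have hmem {p : ℝ} (hp : p ∈ Set.Icc (0 : ℝ) 1) :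
      (⟨xiMix p, isProbabilityMeasure_xiMix hp⟩ : ProbabilityMeasure Ω2) ∈ Mcal :=
    mem_Mcal_of_absolutelyContinuous (xiMix_absolutelyContinuous p)
  have hsup : Fsup inv2 xiM θ = (magnetizedObjective θ (2 * q - 1) : ℝ) := by
    refine le_antisymm (iSup₂_le fun ν _ => ?_) ?_
    · obtain ⟨p, hp, h | h⟩ := eq_xiMix_or_objective_lt θ (ν : Measure Ω2)
      · rw [h, objective_xiMix θ hp]
        exact_mod_cast hmax p hp
      · exact h.le.trans (by exact_mod_cast hmax p hp)
    · rw [← objective_xiMix θ hq]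
      exact le_iSup₂_of_le _ (hmem hq) le_rfl
  ext ν
  simp only [Fset, Set.mem_ofPred_eq, hsup]
  constructor
  · rintro ⟨-, h⟩
    obtain ⟨p, hp, h' | h'⟩ := eq_xiMix_or_objective_lt θ (ν : Measure Ω2)
    · rw [h', objective_xiMix θ hp] at h
      exact ⟨p, hp, by exact_mod_cast h, h'⟩
    · rw [h, EReal.coe_lt_coe_iff] at h'
      exact absurd h' (hmax p hp).not_gt
  · rintro ⟨p, hp, h, h'⟩
    refine ⟨mem_Mcal_of_absolutelyContinuous (h' ▸ xiMix_absolutelyContinuous p), ?_⟩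
    rw [h', objective_xiMix θ hp, h]

lemma abs_two_mul_sub_one_le {p : ℝ} (hp : p ∈ Set.Icc (0 : ℝ) 1) : |2 * p - 1| ≤ 1 :=
  abs_le.2 ⟨by linarith [hp.1], by linarith [hp.2]⟩

lemma Fset_inv2_xiM_of_le_one {θ : ℝ} (hθ : θ ≤ 1) :
    Fset inv2 xiM θ = {ν : ProbabilityMeasure Ω2 | (ν : Measure Ω2) = xiM} := by
  have hlt (p : ℝ) (hp : p ∈ Set.Icc (0 : ℝ) 1) (hne : p ≠ 1 / 2) :
      magnetizedObjective θ (2 * p - 1) < magnetizedObjective θ (2 * (1 / 2) - 1) := by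
    rw [show (2 * (1 / 2) - 1 : ℝ) = 0 by norm_num]
    exact magnetizedObjective_lt_of_le_one hθ (abs_two_mul_sub_one_le hp)
      fun h => hne (by linarith)
  have hhalf : (1 / 2 : ℝ) ∈ Set.Icc (0 : ℝ) 1 := by norm_num
  rw [Fset_inv2_xiM hhalf fun p hp => ?_]
  · ext ν
    simp only [Set.mem_ofPred_eq]
    constructor
    · rintro ⟨p, hp, h, h'⟩
      have : p = 1 / 2 := by
        by_contra hne
        exact (hlt p hp hne).ne h
      rw [h', this, xiMix_half]
    · intro h
      exact ⟨1 / 2, hhalf, rfl, by rw [h, xiMix_half]⟩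
  · rcases eq_or_ne p (1 / 2) with rfl | hne
    · exact le_rfl
    · exact (hlt p hp hne).le

lemma Fset_inv2_xiM_of_root {θ m : ℝ} (hm : 0 < m) (hroot : m = Real.tanh (θ * m)) :
    Fset inv2 xiM θ = {ν : ProbabilityMeasure Ω2 |
      (ν : Measure Ω2) = xiMix ((1 + m) / 2) ∨ (ν : Measure Ω2) = xiMix ((1 - m) / 2)} := by
  have hm₁ := lt_one_of_eq_tanh hroot
  have e₁ : 2 * ((1 + m) / 2) - 1 = m := by ring
  have e₂ : 2 * ((1 - m) / 2) - 1 = -m := by ring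
  have hmem₁ : (1 + m) / 2 ∈ Set.Icc (0 : ℝ) 1 := ⟨by linarith, by linarith⟩
  have hmem₂ : (1 - m) / 2 ∈ Set.Icc (0 : ℝ) 1 := ⟨by linarith, by linarith⟩
  rw [Fset_inv2_xiM hmem₁ fun p hp => ?_]
  · ext ν
    simp only [Set.mem_ofPred_eq, e₁]
    constructor
    · rintro ⟨p, hp, h, h'⟩
      have habs : |2 * p - 1| = m := by
        by_contra hne
        exact (magnetizedObjective_lt_root hm hroot (abs_two_mul_sub_one_le hp) hne).ne h
      rcases eq_or_eq_neg_of_abs_eq habs with hp' | hp'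
      · left; rw [h', show p = (1 + m) / 2 by linarith]
      · right; rw [h', show p = (1 - m) / 2 by linarith]
    · rintro (h | h)
      · exact ⟨_, hmem₁, by rw [e₁], h⟩
      · exact ⟨_, hmem₂, by rw [e₂, magnetizedObjective_neg], h⟩
  · rw [e₁]
    by_cases habs : |2 * p - 1| = m
    · rw [← magnetizedObjective_abs, habs]
    · exact (magnetizedObjective_lt_root hm hroot (abs_two_mul_sub_one_le hp) habs).le

lemma measurable_cdfX (ν : Measure Ω2) [IsFiniteMeasure ν] : Measurable (cdfX ν) :=
  Monotone.measurable fun _ _ hxy =>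
    measureReal_mono fun _ hz => le_trans (α := ℝ) hz hxy

lemma measurable_cdfY (ν : Measure Ω2) [IsFiniteMeasure ν] : Measurable (cdfY ν) :=
  Monotone.measurable fun _ _ hxy =>
    measureReal_mono fun _ hz => le_trans (α := ℝ) hz hxy

lemma cdfX_add_cdfY_eq {ν : Measure Ω2} [IsProbabilityMeasure ν] (z : Ω2) :
    cdfX ν z.1 + cdfY ν z.2 = ν.real ({w | w.1 ≤ z.1} ∪ {w | w.2 ≤ z.2})
      + ν.real ({w | w.1 ≤ z.1} ∩ {w | w.2 ≤ z.2}) :=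
  (measureReal_union_add_inter (measurableSet_le (by fun_prop) (by fun_prop))).symm

lemma cdfX_add_cdfY_of_mem_leftHalf {ν : Measure Ω2} [IsProbabilityMeasure ν] (h : ν ≪ xiM)
    {z : Ω2} (hz : z ∈ xiSegments) (hzl : z ∈ leftHalf) :
    cdfX ν z.1 + cdfY ν z.2 = ν.real leftHalf := by
  obtain ⟨hz₀, hz₂⟩ : 0 ≤ z.1 ∧ z.2 = 1 / 2 - z.1 := by
    rcases hz with ⟨-, hz⟩ | ⟨hz, -⟩
    · exact hz
    · exact absurd hzl hz
  have hz₁ : z.1 < 1 / 2 := hzl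
  have hinter : ({w : Ω2 | w.1 ≤ z.1} ∩ {w : Ω2 | w.2 ≤ z.2} : Set Ω2) =ᵐ[ν] (∅ : Set Ω2) := by
    refine h.ae_le (eventuallyEq_set.2 ?_)
    filter_upwards [ae_xiM_mem, ae_xiM_fst_ne z.1] with w hw hne
    simp only [xiSegments, leftHalf, Set.mem_inter_iff, Set.mem_ofPred_eq,
      Set.mem_empty_iff_false, iff_false] at hw ⊢
    grind
  have hunion : ({w : Ω2 | w.1 ≤ z.1} ∪ {w : Ω2 | w.2 ≤ z.2} : Set Ω2) =ᵐ[ν] leftHalf := by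
    refine h.ae_le (eventuallyEq_set.2 ?_)
    filter_upwards [ae_xiM_mem, ae_xiM_fst_ne 1] with w hw hne
    simp only [xiSegments, leftHalf, Set.mem_union, Set.mem_ofPred_eq] at hw ⊢
    grind
  rw [cdfX_add_cdfY_eq, measureReal_congr hunion, measureReal_congr hinter, measureReal_empty,
    add_zero]

lemma cdfX_add_cdfY_of_notMem_leftHalf {ν : Measure Ω2} [IsProbabilityMeasure ν] (h : ν ≪ xiM)
    {z : Ω2} (hz : z ∈ xiSegments) (hzl : z ∉ leftHalf) :
    cdfX ν z.1 + cdfY ν z.2 = 1 + ν.real leftHalf := by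
  obtain ⟨hz₀, hz₂⟩ : z.1 ≤ 1 ∧ z.2 = 3 / 2 - z.1 := by
    rcases hz with ⟨hz, -⟩ | ⟨-, hz⟩
    · exact absurd hz hzl
    · exact hz
  have hz₁ : 1 / 2 ≤ z.1 := not_lt.1 hzl
  have hinter : ({w : Ω2 | w.1 ≤ z.1} ∩ {w : Ω2 | w.2 ≤ z.2} : Set Ω2) =ᵐ[ν] leftHalf := by
    refine h.ae_le (eventuallyEq_set.2 ?_)
    filter_upwards [ae_xiM_mem, ae_xiM_fst_ne z.1] with w hw hne
    simp only [xiSegments, leftHalf, Set.mem_inter_iff, Set.mem_ofPred_eq] at hw ⊢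
    grind
  have hunion : ({w : Ω2 | w.1 ≤ z.1} ∪ {w : Ω2 | w.2 ≤ z.2} : Set Ω2) =ᵐ[ν] Set.univ := by
    refine h.ae_le (eventuallyEq_set.2 ?_)
    filter_upwards [ae_xiM_mem] with w hw
    simp only [xiSegments, leftHalf, Set.mem_union, Set.mem_ofPred_eq, Set.mem_univ,
      iff_true] at hw ⊢
    grind
  rw [cdfX_add_cdfY_eq, measureReal_congr hunion, measureReal_congr hinter, probReal_univ]

lemma Omap_apply_antidiagonal (ν : Measure Ω2) [IsFiniteMeasure ν] (a : ℝ) :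
    Omap ν {w | w.1 + w.2 = a} = ν {z | cdfX ν z.1 + cdfY ν z.2 = a} :=
  Measure.map_apply (((measurable_cdfX ν).comp measurable_fst).prodMk
    ((measurable_cdfY ν).comp measurable_snd)) (measurableSet_eq_fun (by fun_prop) (by fun_prop))

lemma Omap_xiMix_ne {a b : ℝ} (ha₀ : 0 < a) (ha₁ : a < 1) (hb : b ∈ Set.Icc (0 : ℝ) 1)
    (hab : a ≠ b) : Omap (xiMix a) ≠ Omap (xiMix b) := by
  have := isProbabilityMeasure_xiMix ⟨ha₀.le, ha₁.le⟩
  have := isProbabilityMeasure_xiMix hb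
  have hpos : 0 < Omap (xiMix a) {w | w.1 + w.2 = a} := by
    rw [Omap_apply_antidiagonal]
    refine (show 0 < xiMix a leftHalf by
      rw [xiMix_apply_leftHalf]; exact ENNReal.ofReal_pos.2 ha₀).trans_le (measure_mono_ae ?_)
    filter_upwards [(xiMix_absolutelyContinuous a).ae_le ae_xiM_mem] with z hz hzl
    exact (cdfX_add_cdfY_of_mem_leftHalf (xiMix_absolutelyContinuous a) hz hzl).trans
      (xiMix_real_leftHalf ha₀.le)
  have hzero : Omap (xiMix b) {w | w.1 + w.2 = a} = 0 := by
    rw [Omap_apply_antidiagonal]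
    refine measure_eq_zero_iff_ae_notMem.2 ?_
    filter_upwards [(xiMix_absolutelyContinuous b).ae_le ae_xiM_mem] with z hz hza
    have hza' : cdfX (xiMix b) z.1 + cdfY (xiMix b) z.2 = a := hza
    by_cases hzl : z ∈ leftHalf
    · rw [cdfX_add_cdfY_of_mem_leftHalf (xiMix_absolutelyContinuous b) hz hzl,
        xiMix_real_leftHalf hb.1] at hza'
      exact hab hza'.symm
    · rw [cdfX_add_cdfY_of_notMem_leftHalf (xiMix_absolutelyContinuous b) hz hzl,
        xiMix_real_leftHalf hb.1] at hza'
      linarith [hb.1]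
  intro heq
  rw [heq, hzero] at hpos
  exact hpos.ne rfl

lemma image_Omap_eq_pair {μ₁ μ₂ : Measure Ω2} (h₁ : IsProbabilityMeasure μ₁)
    (h₂ : IsProbabilityMeasure μ₂) :
    (fun ν : ProbabilityMeasure Ω2 => Omap (ν : Measure Ω2)) ''
      {ν | (ν : Measure Ω2) = μ₁ ∨ (ν : Measure Ω2) = μ₂} = {Omap μ₁, Omap μ₂} := by
  ext μ
  constructor
  · rintro ⟨ν, hν | hν, rfl⟩
    · exact Or.inl (congrArg Omap hν)
    · exact Or.inr (congrArg Omap hν)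
  · rintro (rfl | rfl)
    · exact ⟨⟨μ₁, h₁⟩, Or.inl rfl, rfl⟩
    · exact ⟨⟨μ₂, h₂⟩, Or.inr rfl, rfl⟩

/-- Proposition 1.16: description of `ℱ(21,ξ,θ)`: it equals `{ξ}` for
`θ ≤ 1`; for `θ > 1` there is a unique positive root `m` of `x = tanh(θx)` and
`ℱ(21,ξ,θ)` consists of the two mixtures `((1±m)/2)ξ₁₁ + ((1∓m)/2)ξ₂₂`; moreover
`𝒪(ℱ(21,ξ,θ))` has exactly two elements for `θ > 1`. -/
theorem optimizers_for_xi :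
    (∀ θ : ℝ, θ ≤ 1 →
      Fset inv2 xiM θ = {ν : ProbabilityMeasure Ω2 | (ν : Measure Ω2) = xiM}) ∧
    (∀ θ : ℝ, 1 < θ → ∃! m : ℝ, 0 < m ∧ m = Real.tanh (θ * m)) ∧
    (∀ θ : ℝ, 1 < θ → ∀ m : ℝ, 0 < m → m = Real.tanh (θ * m) →
      Fset inv2 xiM θ = {ν : ProbabilityMeasure Ω2 |
          (ν : Measure Ω2) =
            ENNReal.ofReal ((1 + m)/2) • xi11 + ENNReal.ofReal ((1 - m)/2) • xi22 ∨
          (ν : Measure Ω2) =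
            ENNReal.ofReal ((1 - m)/2) • xi11 + ENNReal.ofReal ((1 + m)/2) • xi22} ∧
      ∃ m₁ m₂ : Measure Ω2, m₁ ≠ m₂ ∧
        (fun ν : ProbabilityMeasure Ω2 => Omap (↑ν)) '' Fset inv2 xiM θ = {m₁, m₂}) := by
  refine ⟨fun θ hθ => Fset_inv2_xiM_of_le_one hθ, fun θ hθ => existsUnique_pos_eq_tanh hθ,
    fun θ _ m hm hroot => ?_⟩
  have hm₁ := lt_one_of_eq_tanh hroot
  have hmem₁ : (1 + m) / 2 ∈ Set.Icc (0 : ℝ) 1 := ⟨by linarith, by linarith⟩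
  have hmem₂ : (1 - m) / 2 ∈ Set.Icc (0 : ℝ) 1 := ⟨by linarith, by linarith⟩
  have hF := Fset_inv2_xiM_of_root hm hroot
  refine ⟨?_, Omap (xiMix ((1 + m) / 2)), Omap (xiMix ((1 - m) / 2)),
    Omap_xiMix_ne (by linarith) (by linarith) hmem₂ (by intro h; linarith), ?_⟩
  · rw [hF]
    simp only [xiMix, show 1 - (1 + m) / 2 = (1 - m) / 2 by ring,
      show 1 - (1 - m) / 2 = (1 + m) / 2 by ring]
  · rw [hF, image_Omap_eq_pair (isProbabilityMeasure_xiMix hmem₁)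
      (isProbabilityMeasure_xiMix hmem₂)]

end
end

section
/- Let 21 ∈ S_2 denote the inversion pattern and let μ ∈ ℳ be CC with respect to 21. Then: (i) the topological support supp(μ) has empty interior. If moreover μ ∈ ℳ̃ is a permuton, then: (ii) there exists b ∈ [0,1] such that every (x,y) ∈ supp(μ) with μ([0,x]×[0,y]) = 0 satisfies x + y = b, and (iii) for this b, μ({(x,y) ∈ [0,1]² : x + y < b}) = 0. -/
open MeasureTheory Filter Topology
open scoped ENNReal

noncomputable section

/-- The points forming an inversion with `z`. -/
def inversionSet (z : Ω2) : Set Ω2 :=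
  {w | (z.1 < w.1 ∧ w.2 < z.2) ∨ (w.1 < z.1 ∧ z.2 < w.2)}

lemma hPat_inv2_s18 (z : Ω2) (w : Fin 1 → Ω2) :
    hPat inv2 (Fin.cons z w) =
      (inversionSet z).indicator 1 (w 0) := by
  classical
  have key : (∃ τ : Equiv.Perm (Fin 2),
      StrictMono (fun i => ((Fin.cons z w : Fin 2 → Ω2) (τ i)).1) ∧
        StrictMono (fun i => ((Fin.cons z w : Fin 2 → Ω2) (τ (inv2⁻¹ i))).2)) ↔
      (z.1 < (w 0).1 ∧ (w 0).2 < z.2) ∨ ((w 0).1 < z.1 ∧ z.2 < (w 0).2) := by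
    have hτ : ∀ τ : Equiv.Perm (Fin 2), τ = 1 ∨ τ = Equiv.swap 0 1 := by decide
    have h1 : (Fin.cons z w : Fin 2 → Ω2) 1 = w 0 := rfl
    constructor
    · rintro ⟨τ, h⟩
      rcases hτ τ with rfl | rfl <;>
        simp [Fin.strictMono_iff_lt_succ, inv2, h1] at h <;> tauto
    · rintro (h | h)
      · refine ⟨1, ?_⟩
        simpa [Fin.strictMono_iff_lt_succ, inv2, h1] using h
      · refine ⟨Equiv.swap 0 1, ?_⟩
        simpa [Fin.strictMono_iff_lt_succ, inv2, h1] using h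
  simp only [hPat, Set.indicator, inversionSet, key, Set.mem_ofPred_eq, Pi.one_apply]
  congr

lemma measurableSet_inversionSet (z : Ω2) : MeasurableSet (inversionSet z) := by
  unfold inversionSet
  measurability

lemma integral_hPat_inv2 (μ : Measure Ω2) [IsProbabilityMeasure μ] (z : Ω2) :
    ∫ w : Fin 1 → Ω2, hPat inv2 (Fin.cons z w) ∂pmeas μ 1 = μ.real (inversionSet z) := by
  simp_rw [hPat_inv2_s18]
  have h := (measurePreserving_funUnique μ (Fin 1)).integral_comp'
    (g := (inversionSet z).indicator (1 : Ω2 → ℝ))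
  rw [← integral_indicator_one (measurableSet_inversionSet z), ← h]
  rfl

lemma ae_fst_ne {μ : Measure Ω2} {x : ℝ} (h : μ.map Prod.fst {x} = 0) :
    ∀ᵐ w ∂μ, w.1 ≠ x := by
  rw [Measure.map_apply measurable_fst (measurableSet_singleton x)] at h
  simp only [ae_iff, ne_eq, not_not]
  exact h

lemma ae_snd_ne {μ : Measure Ω2} {y : ℝ} (h : μ.map Prod.snd {y} = 0) :
    ∀ᵐ w ∂μ, w.2 ≠ y := by
  rw [Measure.map_apply measurable_snd (measurableSet_singleton y)] at h
  simp only [ae_iff, ne_eq, not_not]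
  exact h

lemma continuous_measureReal_inversionSet (μ : Measure Ω2) [IsProbabilityMeasure μ]
    (hx : ∀ x, μ.map Prod.fst {x} = 0) (hy : ∀ y, μ.map Prod.snd {y} = 0) :
    Continuous fun z => μ.real (inversionSet z) := by
  simp_rw [← fun z => integral_indicator_one (μ := μ) (measurableSet_inversionSet z)]
  refine continuous_iff_continuousAt.2 fun z₀ => ?_
  refine continuousAt_of_dominated (bound := fun _ => 1) (.of_forall fun z => ?_)
    (.of_forall fun z => .of_forall fun w => ?_) (integrable_const _) ?_
  · exact (measurable_one.indicator (measurableSet_inversionSet z)).aestronglyMeasurable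
  · by_cases hw : w ∈ inversionSet z <;> simp [hw]
  · filter_upwards [ae_fst_ne (hx z₀.1), ae_snd_ne (hy z₀.2)] with w h1 h2
    have side : ∀ {f : Ω2 → ℝ} {a : ℝ}, Continuous f → a ≠ f z₀ →
        ∀ᶠ z in 𝓝 z₀, ((f z < a ↔ f z₀ < a) ∧ (a < f z ↔ a < f z₀)) := by
      intro f a hf ha
      rcases ha.lt_or_gt with h | h
      · filter_upwards [hf.continuousAt.eventually (lt_mem_nhds h)] with z hz
        exact ⟨iff_of_false hz.not_gt h.not_gt, iff_of_true hz h⟩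
      · filter_upwards [hf.continuousAt.eventually (gt_mem_nhds h)] with z hz
        exact ⟨iff_of_true hz h, iff_of_false hz.not_gt h.not_gt⟩
    refine (continuousAt_const (y := (inversionSet z₀).indicator (1 : Ω2 → ℝ) w)).congr ?_
    filter_upwards [side continuous_fst h1, side continuous_snd h2] with z h3 h4
    have hiff : w ∈ inversionSet z ↔ w ∈ inversionSet z₀ := by
      simp only [inversionSet, Set.mem_ofPred_eq, h3.1, h3.2, h4.1, h4.2]
    by_cases hw : w ∈ inversionSet z₀ <;> simp [hiff, hw]

lemma measureReal_inversionSet (μ : Measure Ω2) [IsProbabilityMeasure μ] (z : Ω2)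
    (hx : μ.map Prod.fst {z.1} = 0) (hy : μ.map Prod.snd {z.2} = 0) :
    μ.real (inversionSet z) = (μ.map Prod.fst).real (Set.Iic z.1) +
      (μ.map Prod.snd).real (Set.Iic z.2) - 2 * μ.real (Set.Iic z) := by
  rw [map_measureReal_apply measurable_fst measurableSet_Iic,
    map_measureReal_apply measurable_snd measurableSet_Iic]
  have m1 : MeasurableSet (Prod.fst ⁻¹' Set.Iic z.1 : Set Ω2) :=
    measurable_fst measurableSet_Iic
  have m2 : MeasurableSet (Prod.snd ⁻¹' Set.Iic z.2 : Set Ω2) :=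
    measurable_snd measurableSet_Iic
  have hint : ∀ {s : Set Ω2}, MeasurableSet s → Integrable (s.indicator (1 : Ω2 → ℝ)) μ :=
    fun hs => (integrable_const (1 : ℝ)).indicator hs
  rw [← integral_indicator_one (measurableSet_inversionSet z), ← integral_indicator_one m1,
    ← integral_indicator_one m2, ← integral_indicator_one measurableSet_Iic,
    ← integral_const_mul, ← integral_add' (hint m1) (hint m2),
    ← integral_sub ((hint m1).add (hint m2)) ((hint measurableSet_Iic).const_mul 2)]
  refine integral_congr_ae ?_
  filter_upwards [ae_fst_ne hx, ae_snd_ne hy] with w h1 h2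
  have e1 : w.1 ≤ z.1 ↔ w.1 < z.1 := ⟨fun h => h.lt_of_ne h1, le_of_lt⟩
  have e2 : w.2 ≤ z.2 ↔ w.2 < z.2 := ⟨fun h => h.lt_of_ne h2, le_of_lt⟩
  rcases h1.lt_or_gt with h1 | h1 <;> rcases h2.lt_or_gt with h2 | h2 <;>
    norm_num [Set.indicator, inversionSet, Prod.le_def, e1, e2, h1, h2, h1.not_gt, h2.not_gt]

lemma msupport_subset_of_isClosed {μ : Measure Ω2} {s : Set Ω2} (hs : IsClosed s)
    (h : ∀ᵐ z ∂μ, z ∈ s) : msupport μ ⊆ s := by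
  intro z hz
  by_contra hzs
  exact (hz sᶜ hs.isOpen_compl hzs).ne' h

lemma measureReal_Ioc_prod_Ioc (μ : Measure Ω2) [IsFiniteMeasure μ] {a b c d : ℝ}
    (hab : a ≤ b) (hcd : c ≤ d) :
    μ.real (Set.Ioc a b ×ˢ Set.Ioc c d) = μ.real (Set.Iic (b, d)) - μ.real (Set.Iic (a, d)) -
      μ.real (Set.Iic (b, c)) + μ.real (Set.Iic (a, c)) := by
  have hint : ∀ {s : Set Ω2}, MeasurableSet s → Integrable (s.indicator (1 : Ω2 → ℝ)) μ :=
    fun hs => (integrable_const (1 : ℝ)).indicator hs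
  have hI : ∀ p : Ω2, Integrable ((Set.Iic p).indicator (1 : Ω2 → ℝ)) μ :=
    fun p => hint measurableSet_Iic
  rw [← integral_indicator_one (measurableSet_Ioc.prod measurableSet_Ioc)]
  simp_rw [← fun p : Ω2 => integral_indicator_one (μ := μ) (measurableSet_Iic (a := p))]
  rw [← integral_sub' (hI _) (hI _), ← integral_sub' ((hI _).sub (hI _)) (hI _),
    ← integral_add' (((hI _).sub (hI _)).sub (hI _)) (hI _)]
  refine integral_congr_ae (.of_forall fun w => ?_)
  by_cases h1 : w.1 ≤ a <;> by_cases h2 : w.1 ≤ b <;> by_cases h3 : w.2 ≤ c <;>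
    by_cases h4 : w.2 ≤ d <;>
    first
    | (exfalso; linarith)
    | norm_num [Set.indicator, Prod.le_def, h1, h2, h3, h4]

theorem interior_msupport_eq_empty (μ : Measure Ω2) [IsProbabilityMeasure μ]
    (hx : ∀ x, μ.map Prod.fst {x} = 0) (hy : ∀ y, μ.map Prod.snd {y} = 0) {c : ℝ}
    (hc : ∀ z ∈ msupport μ, μ.real (inversionSet z) = c) :
    interior (msupport μ) = ∅ := by
  refine Set.eq_empty_of_forall_notMem fun p hp => ?_
  obtain ⟨ε, hε, hball⟩ := Metric.mem_nhds_iff.1 (mem_interior_iff_mem_nhds.1 hp)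
  have hmem : ∀ s t : ℝ, |s| = ε / 2 → |t| = ε / 2 → (p.1 + s, p.2 + t) ∈ msupport μ := by
    intro s t hs ht
    refine hball ?_
    rw [Metric.mem_ball, Prod.dist_eq]
    simp [hs, ht, hε]
  have hp' : |ε / 2| = ε / 2 := abs_of_pos (half_pos hε)
  have hn' : |-(ε / 2)| = ε / 2 := by rw [abs_neg, hp']
  have hval := fun s t hs ht =>
    (measureReal_inversionSet μ (p.1 + s, p.2 + t) (hx _) (hy _)).symm.trans
      (hc _ (hmem s t hs ht))
  have h1 := hval _ _ hp' hp'
  have h2 := hval _ _ hp' hn'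
  have h3 := hval _ _ hn' hp'
  have h4 := hval _ _ hn' hn'
  have hrect := measureReal_Ioc_prod_Ioc μ (a := p.1 + -(ε / 2)) (b := p.1 + ε / 2)
    (c := p.2 + -(ε / 2)) (d := p.2 + ε / 2) (by linarith) (by linarith)
  have hpos := interior_subset hp (Set.Ioo (p.1 + -(ε / 2)) (p.1 + ε / 2) ×ˢ
    Set.Ioo (p.2 + -(ε / 2)) (p.2 + ε / 2)) (isOpen_Ioo.prod isOpen_Ioo)
    (by constructor <;> constructor <;> linarith)
  have hzero : μ.real (Set.Ioc (p.1 + -(ε / 2)) (p.1 + ε / 2) ×ˢ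
      Set.Ioc (p.2 + -(ε / 2)) (p.2 + ε / 2)) = 0 := by
    simp only at h1 h2 h3 h4
    linarith
  rw [measureReal_eq_zero_iff] at hzero
  exact hpos.ne' (measure_mono_null (Set.prod_mono Set.Ioo_subset_Ioc_self
    Set.Ioo_subset_Ioc_self) hzero)

lemma unif01_real_Iic {x : ℝ} (hx : x ∈ Set.Icc (0 : ℝ) 1) : unif01.real (Set.Iic x) = x := by
  have h : Set.Iic x ∩ Set.Icc (0 : ℝ) 1 = Set.Icc 0 x := by
    ext t
    exact ⟨fun h => ⟨h.2.1, h.1⟩, fun h => ⟨h.2, h.1, h.2.trans hx.2⟩⟩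
  rw [unif01, measureReal_restrict_apply measurableSet_Iic, h, Real.volume_real_Icc_of_le hx.1,
    sub_zero]

/-- Proposition 1.21: if `μ ∈ ℳ` is CC with respect to `21`, then the
support of `μ` has empty interior; if moreover `μ` is a permuton, there is `b ∈ [0,1]` such
that every `(x,y)` in the support with `μ([0,x]×[0,y]) = 0` lies on the line `x + y = b`,
and `μ` gives no mass to the open triangle `{(x,y) ∈ [0,1]² : x + y < b}`. -/
theorem cc_support_structure (μ : ProbabilityMeasure Ω2) (hμ : μ ∈ Mcal)
    (hcc : IsCC (k := 1) inv2 (↑μ)) :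
    interior (msupport (↑μ : Measure Ω2)) = ∅ ∧
    (μ ∈ Mtilde → ∃ b ∈ Set.Icc (0 : ℝ) 1,
      (∀ p ∈ msupport ((↑μ : Measure Ω2)),
        (↑μ : Measure Ω2) (Set.Icc 0 p.1 ×ˢ Set.Icc 0 p.2) = 0 → p.1 + p.2 = b) ∧
      (↑μ : Measure Ω2) {p : Ω2 | p ∈ unitSq ∧ p.1 + p.2 < b} = 0) := by
  obtain ⟨hsq, hx, hy⟩ := hμ
  obtain ⟨c, hc, hcc⟩ := hcc
  simp_rw [integral_hPat_inv2] at hcc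
  have hsup : ∀ z ∈ msupport (μ : Measure Ω2), (μ : Measure Ω2).real (inversionSet z) = c :=
    msupport_subset_of_isClosed (isClosed_eq
      (continuous_measureReal_inversionSet (μ : Measure Ω2) hx hy) continuous_const) hcc
  refine ⟨interior_msupport_eq_empty _ hx hy hsup, fun hperm => ⟨c, hc, ?_, ?_⟩⟩
  all_goals
    obtain ⟨-, hX, hY⟩ := hperm
    have hclosed : IsClosed unitSq := isClosed_Icc.prod isClosed_Icc
    have hae : ∀ᵐ z ∂(μ : Measure Ω2), z ∈ unitSq :=
      (prob_compl_eq_zero_iff hclosed.measurableSet).2 hsq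
    have hval : ∀ z ∈ unitSq, (μ : Measure Ω2).real (inversionSet z) =
        z.1 + z.2 - 2 * (μ : Measure Ω2).real (Set.Iic z) := by
      intro z hz
      rw [measureReal_inversionSet _ z (hx _) (hy _), hX, hY, unif01_real_Iic hz.1,
        unif01_real_Iic hz.2]
  · intro p hp h0
    have hpsq := msupport_subset_of_isClosed hclosed hae hp
    have hzero : (μ : Measure Ω2) (Set.Iic p) = 0 := by
      rw [← h0]
      refine measure_congr ?_
      filter_upwards [hae] with w hw
      exact propext ⟨fun h => ⟨⟨hw.1.1, h.1⟩, hw.2.1, h.2⟩, fun h => ⟨h.1.2, h.2.2⟩⟩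
    have h1 := hval p hpsq
    rw [hsup p hp, (measureReal_eq_zero_iff).2 hzero] at h1
    linarith
  · refine measure_mono_null ?_ hcc
    rintro p ⟨hp, hlt⟩ (heq : _ = c)
    have := hval p hp
    have : 0 ≤ (μ : Measure Ω2).real (Set.Iic p) := measureReal_nonneg
    linarith

end
end
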